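/- arXiv:1212.3627 — 3 statements merged into one kernel-verified Lean document; each statement's English description precedes it below -/
import Mathlib

section
/- Fix natural numbers a, b, k with 4·k² < a < b − k. Let G be a bipartite graph with vertex classes A and B, |A| = a, |B| = b, such that the set of pairs (x, y) with x ∈ A, y ∈ B that are NOT edges of G can be covered by the edge sets of k forests (i.e., G is obtained from the complete bipartite graph K_{a,b} by removing k forests). Then G contains a matching of size a − k. -/
open SimpleGraph

/-- A forest on `n` vertices has at most `n` edges. -/
lemma SimpleGraph.IsAcyclic.card_edgeFinset_le {V : Type*} [Fintype V] {F : SimpleGraph V}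
    [Fintype F.edgeSet] (hF : F.IsAcyclic) : F.edgeFinset.card ≤ Fintype.card V := by
  classical
  cases isEmpty_or_nonempty V with
  | inl h =>
    rw [Finset.card_eq_zero.2]
    · exact Nat.zero_le _
    · exact Finset.eq_empty_of_forall_notMem fun e ↦ e.ind fun x _ ↦ isEmptyElim x
  | inr h =>
    obtain ⟨T, hFT, -, hT⟩ := connected_top.exists_isTree_le_of_le_of_isAcyclic le_top hF
    have hcard := hT.card_edgeFinset
    have hle : F.edgeFinset.card ≤ T.edgeFinset.card :=
      Finset.card_le_card (edgeFinset_mono hFT)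
    omega

/-- A forest has at most `|S| + |T|` edges between disjoint finite sets `S` and `T`. -/
lemma SimpleGraph.IsAcyclic.card_interedges_le {V : Type*} {F : SimpleGraph V}
    [DecidableRel F.Adj] (hF : F.IsAcyclic) {S T : Finset V} (hST : Disjoint S T) :
    (F.interedges S T).card ≤ S.card + T.card := by
  classical
  set U : Finset V := S ∪ T
  have hcard := (hF.induce (U : Set V)).card_edgeFinset_le
  have hU : Fintype.card (U : Set V) = S.card + T.card := by
    simp [U, Finset.card_union_of_disjoint hST]
  rw [hU] at hcard
  refine le_trans ?_ hcard
  calc (F.interedges S T).card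
      = ((F.interedges S T).image fun p ↦ s(p.1, p.2)).card := by
        refine (Finset.card_image_of_injOn ?_).symm
        rintro ⟨x, y⟩ hp ⟨x', y'⟩ hq h
        simp only [Finset.mem_coe, mem_interedges_iff] at hp hq
        rcases Sym2.eq_iff.1 h with ⟨rfl, rfl⟩ | ⟨rfl, rfl⟩
        · rfl
        · exact absurd hq.2.1 (Finset.disjoint_left.1 hST hp.1)
    _ ≤ ((F.induce (U : Set V)).edgeFinset.image (Sym2.map Subtype.val)).card := by
        refine Finset.card_le_card fun e he ↦ ?_
        obtain ⟨⟨x, y⟩, hp, rfl⟩ := Finset.mem_image.1 he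
        obtain ⟨hx, hy, hxy⟩ := (mem_interedges_iff F).1 hp
        have hxU : x ∈ (U : Set V) := by simp [U, hx]
        have hyU : y ∈ (U : Set V) := by simp [U, hy]
        exact Finset.mem_image.2 ⟨s(⟨x, hxU⟩, ⟨y, hyU⟩), by simpa using hxy, rfl⟩
    _ ≤ _ := Finset.card_image_le

/-- If `k` forests cover all pairs between disjoint sets `S` and `T`, then
`|S| |T| ≤ k (|S| + |T|)`. -/
lemma card_mul_card_le_of_forests_cover {V : Type*} {k : ℕ} {F : Fin k → SimpleGraph V}
    (hF : ∀ i, (F i).IsAcyclic) {S T : Finset V} (hST : Disjoint S T)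
    (hcover : ∀ x ∈ S, ∀ y ∈ T, ∃ i, (F i).Adj x y) :
    S.card * T.card ≤ k * (S.card + T.card) := by
  classical
  calc S.card * T.card = (S ×ˢ T).card := (Finset.card_product S T).symm
    _ ≤ (Finset.univ.biUnion fun i ↦ (F i).interedges S T).card := by
        refine Finset.card_le_card fun p hp ↦ ?_
        obtain ⟨hx, hy⟩ := Finset.mem_product.1 hp
        obtain ⟨i, hi⟩ := hcover p.1 hx p.2 hy
        exact Finset.mem_biUnion.2 ⟨i, Finset.mem_univ i, (mem_interedges_iff _).2 ⟨hx, hy, hi⟩⟩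
    _ ≤ (Finset.univ : Finset (Fin k)).card * (S.card + T.card) :=
        Finset.card_biUnion_le_card_mul _ _ _ fun i _ ↦ (hF i).card_interedges_le hST
    _ = k * (S.card + T.card) := by simp

/-- Hall's theorem with deficiency `k`. -/
lemma exists_injective_of_card_le_card_biUnion_add {ι α : Type*} [Fintype ι] [DecidableEq α]
    (t : ι → Finset α) (k : ℕ) (h : ∀ s : Finset ι, s.card ≤ (s.biUnion t).card + k) :
    ∃ (I : Finset ι) (f : I → α),
      Fintype.card ι ≤ I.card + k ∧ Function.Injective f ∧ ∀ i : I, f i ∈ t i := by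
  classical
  -- Adjoin `k` dummy elements, each allowed as a partner of every index.
  obtain ⟨g, hg, hgt⟩ := (Finset.all_card_le_biUnion_card_iff_exists_injective
    fun i ↦ (t i).disjSum (Finset.univ : Finset (Fin k))).1 fun s ↦ by
      rcases s.eq_empty_or_nonempty with rfl | ⟨i₀, hi₀⟩
      · simp
      calc s.card ≤ (s.biUnion t).card + k := h s
        _ = ((s.biUnion t).disjSum (Finset.univ : Finset (Fin k))).card := by
            simp [Finset.card_disjSum]
        _ ≤ _ := Finset.card_le_card fun z hz ↦ by
            rcases z with z | z
            · simpa using hz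
            · simpa using ⟨i₀, hi₀⟩
  set I : Finset ι := Finset.univ.filter fun i ↦ (g i).isLeft
  have hleft : ∀ i ∈ I, ∃ y ∈ t i, g i = Sum.inl y := fun i hi ↦ by
    obtain ⟨y, hy⟩ := Sum.isLeft_iff.1 (Finset.mem_filter.1 hi).2
    refine ⟨y, ?_, hy⟩
    simpa [hy] using hgt i
  have hdummy : Iᶜ.card ≤ k := by
    calc Iᶜ.card = (Iᶜ.image g).card := (Finset.card_image_of_injective _ hg).symm
      _ ≤ ((Finset.univ : Finset (Fin k)).image Sum.inr).card := by
          refine Finset.card_le_card fun z hz ↦ ?_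
          obtain ⟨i, hi, rfl⟩ := Finset.mem_image.1 hz
          cases hgi : g i with
          | inl y => simp [I, hgi] at hi
          | inr y => simp
      _ ≤ k := Finset.card_image_le.trans (by simp)
  have hcompl := Finset.card_add_card_compl I
  choose f hft hfg using fun i : I ↦ hleft i i.2
  refine ⟨I, f, by omega, fun i j hij ↦ Subtype.ext (hg ?_), hft⟩
  rw [hfg, hfg, hij]

/-- Claim 2.4: if `4k² < a < b - k` and `G` is obtained from the complete bipartite graph
`K_{a,b}` (with classes `A`, `B`) by removing `k` forests, then `G` contains a matching of
size `a - k`. -/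
theorem matching_after_removing_forests (a b k : ℕ) (h1 : 4 * k ^ 2 < a) (h2 : a < b - k)
    {V : Type} (G : SimpleGraph V) (A B : Finset V)
    (hA : A.card = a) (hB : B.card = b) (hdisj : Disjoint A B)
    (hbip : ∀ x y : V, G.Adj x y → (x ∈ A ∧ y ∈ B) ∨ (x ∈ B ∧ y ∈ A))
    (F : Fin k → SimpleGraph V) (hF : ∀ i, (F i).IsAcyclic)
    (hcover : ∀ x ∈ A, ∀ y ∈ B, ¬ G.Adj x y → ∃ i, (F i).Adj x y) :
    ∃ xs ys : Fin (a - k) → V,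
      Function.Injective xs ∧ Function.Injective ys ∧
      (∀ i, xs i ∈ A) ∧ (∀ i, ys i ∈ B) ∧
      (∀ i, G.Adj (xs i) (ys i)) := by
  classical
  obtain ⟨I, f, hI, hf, hft⟩ := exists_injective_of_card_le_card_biUnion_add
    (fun x : A ↦ B.filter (G.Adj x)) k fun s ↦ by
      by_contra! hs
      set N : Finset V := s.biUnion fun x : A ↦ B.filter (G.Adj x)
      set S : Finset V := s.map (Function.Embedding.subtype _)
      have hSA : S ⊆ A := fun x hx ↦ by
        obtain ⟨y, -, rfl⟩ := Finset.mem_map.1 hx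
        exact y.2
      have hNB : N ⊆ B := Finset.biUnion_subset.2 fun x _ ↦ Finset.filter_subset _ _
      have hprod := card_mul_card_le_of_forests_cover (S := S) (T := B \ N) hF
        (hdisj.mono hSA Finset.sdiff_subset) fun x hx y hy ↦ by
          obtain ⟨x, hxs, rfl⟩ := Finset.mem_map.1 hx
          obtain ⟨hyB, hyN⟩ := Finset.mem_sdiff.1 hy
          exact hcover x x.2 y hyB fun hxy ↦
            hyN (Finset.mem_biUnion.2 ⟨x, hxs, Finset.mem_filter.2 ⟨hyB, hxy⟩⟩)
      have hS : S.card = s.card := Finset.card_map _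
      have hSa : S.card ≤ a := hA ▸ Finset.card_le_card hSA
      have hT : (B \ N).card + N.card = b := hB ▸ Finset.card_sdiff_add_card_eq_card hNB
      obtain ⟨p, hp⟩ : ∃ p, S.card = k + 1 + p := Nat.exists_eq_add_of_le (by omega)
      obtain ⟨q, hq⟩ : ∃ q, (B \ N).card = k + 1 + q := Nat.exists_eq_add_of_le (by omega)
      have hpq : a ≤ p + q := by omega
      rw [hp, hq] at hprod
      nlinarith [Nat.zero_le (p * q)]
  rw [Fintype.card_coe, hA] at hI
  obtain ⟨e⟩ : Nonempty (Fin (a - k) ↪ I) :=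
    Function.Embedding.nonempty_of_card_le (by simpa using hI)
  exact ⟨fun i ↦ (e i).1.1, fun i ↦ f (e i),
    Subtype.val_injective.comp (Subtype.val_injective.comp e.injective), hf.comp e.injective,
    fun i ↦ (e i).1.2, fun i ↦ (Finset.mem_filter.1 (hft (e i))).1,
    fun i ↦ (Finset.mem_filter.1 (hft (e i))).2⟩
end

section
/- There exists N such that for every n ≥ N the following holds, with t = ⌊(1/10)·n^(1/4)⌋. Let T be a tree with at least n − t + 1 and at most n vertices such that: T has no set of at most n^(1/4) vertices whose neighborhoods together contain at least n^(1/2) leaves of T, and T has no set of n^(1/2) independent leaves. Then T contains a path on 3t + 2 vertices all of whose internal vertices have degree 2 in T, and moreover T contains a set W of at least n^(1/2) vertices of degree 2 in T such that any two vertices of W are at distance at least 2 from each other in T and every vertex of W is at distance at least 2 from both endpoints of the path. -/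
open SimpleGraph

/-- A vertex of degree `1`. -/
def IsLeaf {V : Type} (G : SimpleGraph V) (v : V) : Prop :=
  (G.neighborSet v).ncard = 1

/-- A set of independent leaves: all its members are leaves and the neighbors of distinct
members are distinct. -/
def IndepLeaves {V : Type} (G : SimpleGraph V) (L : Set V) : Prop :=
  (∀ v ∈ L, IsLeaf G v) ∧
    ∀ u ∈ L, ∀ v ∈ L, u ≠ v → ∀ x y, G.Adj u x → G.Adj v y → x ≠ y

namespace SimpleGraph

variable {V : Type} {T : SimpleGraph V}

/-- In a rooted tree, a vertex has at most one neighbor closer to the root. -/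
theorem IsTree.eq_of_adj_of_dist_eq (hT : T.IsTree) (r : V) {x y z : V} (hy : T.Adj x y)
    (hz : T.Adj x z) (hdy : T.dist r x = T.dist r y + 1) (hdz : T.dist r x = T.dist r z + 1) :
    y = z := by
  obtain ⟨p, hp⟩ := hT.connected.exists_walk_length_eq_dist y r
  obtain ⟨q, hq⟩ := hT.connected.exists_walk_length_eq_dist z r
  have hp' : (Walk.cons hy p).IsPath := Walk.isPath_of_length_eq_dist _ (by
    rw [Walk.length_cons, hp, T.dist_comm, ← hdy, T.dist_comm])
  have hq' : (Walk.cons hz q).IsPath := Walk.isPath_of_length_eq_dist _ (by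
    rw [Walk.length_cons, hq, T.dist_comm, ← hdz, T.dist_comm])
  have := congrArg Walk.snd ((hT.existsUnique_path x r).unique hp' hq')
  simpa using this

/-- A parent function for a tree rooted at `r`. -/
theorem IsTree.exists_parent (hT : T.IsTree) (r : V) :
    ∃ par : V → V, ∀ x y, T.Adj x y → T.dist r x = T.dist r y + 1 → par x = y := by
  classical
  refine ⟨fun x ↦ if h : ∃ y, T.Adj x y ∧ T.dist r x = T.dist r y + 1 then h.choose else x, ?_⟩
  intro x y hxy hd
  have h : ∃ y, T.Adj x y ∧ T.dist r x = T.dist r y + 1 := ⟨y, hxy, hd⟩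
  simp only [dif_pos h]
  exact hT.eq_of_adj_of_dist_eq r h.choose_spec.1 hxy h.choose_spec.2 hd

/-- If all vertices of a tree outside a small set `B` have degree `2`, then some long path avoids
`B`. -/
theorem IsTree.exists_isPath_disjoint [Fintype V] (hT : T.IsTree) {B : Finset V}
    (hB : ∀ x ∉ B, (T.neighborSet x).ncard = 2) {k : ℕ}
    (hk : B.card * (k + 1) < Fintype.card V) :
    ∃ (u v : V) (p : T.Walk u v), p.IsPath ∧ p.length = k ∧ ∀ w ∈ p.support, w ∉ B := by
  classical
  obtain ⟨r⟩ := hT.connected.nonempty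
  obtain ⟨par, hpar⟩ := hT.exists_parent r
  obtain ⟨v, hv⟩ : ∃ v, v ∉ (B ×ˢ Finset.range (k + 1)).image fun bj ↦ par^[bj.2] bj.1 := by
    by_contra! h
    have h1 := Finset.card_le_card fun x (_ : x ∈ Finset.univ) ↦ h x
    have h2 := h1.trans Finset.card_image_le
    rw [Finset.card_product, Finset.card_range, Finset.card_univ] at h2
    omega
  have hcov : ∀ b j, j ≤ k → par^[j] b = v → b ∉ B := by
    intro b j hj hb hbB
    exact hv (Finset.mem_image.2 ⟨(b, j), by simp [hbB]; omega, hb⟩)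
  have key : ∀ j ≤ k, ∃ w, par^[j] w = v ∧ T.dist r w = T.dist r v + j ∧
      ∃ p : T.Walk w v, p.length = j ∧ ∀ x ∈ p.support, x ∉ B := by
    intro j
    induction j with
    | zero =>
      intro _
      refine ⟨v, rfl, rfl, Walk.nil, rfl, ?_⟩
      simpa using hcov v 0 (by omega) rfl
    | succ j ih =>
      intro hj
      obtain ⟨w, hwv, hd, p, hp, hpB⟩ := ih (by omega)
      have hw : w ∉ B := hpB w p.start_mem_support
      obtain ⟨w', hw', hne⟩ : ∃ w' ∈ T.neighborSet w, w' ≠ par w :=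
        Set.exists_ne_of_one_lt_ncard (by rw [hB w hw]; norm_num) _
      have hd' : T.dist r w' = T.dist r w + 1 := by
        rcases hT.dist_eq_dist_add_one_of_adj r hw' with h | h
        · exact absurd (hpar _ _ hw' h).symm hne
        · exact h
      have hiter : par^[j + 1] w' = v := by
        rw [Function.iterate_succ_apply, hpar w' w (T.adj_symm hw') hd', hwv]
      refine ⟨w', hiter, by omega, Walk.cons (T.adj_symm hw') p, by simp [hp], ?_⟩
      intro x hx
      rw [Walk.support_cons, List.mem_cons] at hx
      rcases hx with rfl | hx
      · exact hcov _ _ hj hiter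
      · exact hpB x hx
  obtain ⟨w, -, hd, p, hp, hpB⟩ := key k le_rfl
  refine ⟨w, v, p, p.isPath_of_length_eq_dist ?_, hp, hpB⟩
  have h1 := T.dist_le p
  have h2 := hT.connected.dist_triangle (u := r) (v := v) (w := w)
  rw [T.dist_comm (u := v)] at h2
  omega

/-- In a nontrivial tree, the vertices of degree other than `2` number at most twice the leaves. -/
theorem IsTree.card_ncard_ne_two_le [Fintype V] [Nontrivial V]
    [DecidablePred (IsLeaf T)] (hT : T.IsTree) :
    (Finset.univ.filter fun x ↦ (T.neighborSet x).ncard ≠ 2).card ≤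
      2 * (Finset.univ.filter (IsLeaf T)).card := by
  classical
  have hdeg : ∀ x, (T.neighborSet x).ncard = T.degree x := fun x ↦ by
    rw [Set.ncard_eq_toFinset_card', Set.toFinset_card, card_neighborSet_eq_degree]
  have hsum := T.sum_degrees_eq_twice_card_edges
  have hedge := hT.card_edgeFinset
  have hpt : ∀ x, 2 + (if (T.neighborSet x).ncard ≠ 2 then 1 else 0) ≤
      T.degree x + 2 * (if IsLeaf T x then 1 else 0) := by
    intro x
    have := hT.connected.preconnected.degree_pos_of_nontrivial x
    have hleaf : IsLeaf T x ↔ T.degree x = 1 := by rw [← hdeg]; rfl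
    simp only [hdeg, hleaf]
    split_ifs <;> omega
  have h := Finset.sum_le_sum fun x (_ : x ∈ Finset.univ) ↦ hpt x
  rw [Finset.sum_add_distrib, Finset.sum_add_distrib, ← Finset.mul_sum, hsum,
    Finset.sum_boole, Finset.sum_boole, Finset.sum_const, Finset.card_univ, smul_eq_mul] at h
  change _ ≤ 2 * _ + 2 * (Finset.univ.filter (IsLeaf T)).card at h
  simp only [Nat.cast_id] at h
  omega

/-- A set `D` of vertices of a tree contains an independent set of at least half its size. -/
theorem IsTree.exists_subset_pairwise_not_adj (hT : T.IsTree) (D : Finset V) :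
    ∃ W ⊆ D, D.card ≤ 2 * W.card ∧ ∀ x ∈ W, ∀ y ∈ W, ¬ T.Adj x y := by
  obtain ⟨c⟩ := hT.colorable_two
  have hcard := Finset.card_filter_add_card_filter_not (s := D) (fun x ↦ c x = 0)
  rcases le_total (D.filter fun x ↦ c x = 0).card (D.filter fun x ↦ ¬ c x = 0).card with h | h
  · refine ⟨D.filter fun x ↦ ¬ c x = 0, Finset.filter_subset _ _, by omega, fun x hx y hy hxy ↦ ?_⟩
    have := c.valid hxy
    simp only [Finset.mem_filter] at hx hy
    grind
  · refine ⟨D.filter fun x ↦ c x = 0, Finset.filter_subset _ _, by omega, fun x hx y hy hxy ↦ ?_⟩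
    have := c.valid hxy
    simp only [Finset.mem_filter] at hx hy
    exact this (hx.2.trans hy.2.symm)

end SimpleGraph

/-- If the preimage under `f` of every set of at most `q` points has at most `s` elements in `L`,
then preimages of larger sets are bounded by splitting them into blocks of size `q`. -/
theorem card_filter_mem_mul_le {α β : Type*} [DecidableEq β] (L : Finset α) (f : α → β) {q : ℕ}
    {s : ℝ} (hs : ∀ S : Finset β, S.card ≤ q → ((L.filter (f · ∈ S)).card : ℝ) ≤ s)
    (P : Finset β) : ((L.filter (f · ∈ P)).card : ℝ) * q ≤ (P.card + q) * s := by
  have hs0 : 0 ≤ s := (Nat.cast_nonneg _).trans (hs ∅ (by simp))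
  induction P using Finset.strongInduction with
  | H P ih =>
    rcases le_or_gt P.card q with h | h
    · have := mul_le_mul_of_nonneg_right (hs P h) (Nat.cast_nonneg q)
      have : 0 ≤ (P.card : ℝ) * s := by positivity
      linarith
    · rcases Nat.eq_zero_or_pos q with rfl | hq
      · simp only [Nat.cast_zero, mul_zero]
        positivity
      obtain ⟨S, hSP, hS⟩ := Finset.exists_subset_card_eq h.le
      have hss : P \ S ⊂ P := Finset.sdiff_ssubset hSP (Finset.card_pos.1 (by omega))
      have h1 := ih _ hss
      have h2 := mul_le_mul_of_nonneg_right (hs S hS.le) (Nat.cast_nonneg (α := ℝ) q)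
      have h3 : (L.filter (f · ∈ P)).card ≤
          (L.filter (f · ∈ P \ S)).card + (L.filter (f · ∈ S)).card := by
        classical
        refine (Finset.card_le_card ?_).trans (Finset.card_union_le _ _)
        intro x hx
        simp only [Finset.mem_union, Finset.mem_filter, Finset.mem_sdiff] at hx ⊢
        tauto
      have h4 : ((P \ S).card : ℝ) + q = P.card := by
        rw [← hS]
        exact_mod_cast Finset.card_sdiff_add_card_eq_card hSP
      have h3' : ((L.filter (f · ∈ P)).card : ℝ) ≤
          (L.filter (f · ∈ P \ S)).card + (L.filter (f · ∈ S)).card := by exact_mod_cast h3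
      have h5 := mul_le_mul_of_nonneg_right h3' (Nat.cast_nonneg (α := ℝ) q)
      rw [h4] at h1
      nlinarith

/-- A graph without `a ^ 2` independent leaves, in which no `a` vertices see `a ^ 2` leaves, has
about `a ^ 3` leaves at most. -/
theorem card_leaves_mul_le {V : Type} [Fintype V] (T : SimpleGraph V)
    [DecidablePred (IsLeaf T)] {a : ℝ} (ha : 1 ≤ a)
    (hS : ¬ ∃ S : Set V, (S.ncard : ℝ) ≤ a ∧
      a ^ 2 ≤ (({w | w ∉ S ∧ (∃ u ∈ S, T.Adj u w) ∧ IsLeaf T w} : Set _).ncard : ℝ))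
    (hL : ¬ ∃ L : Set V, IndepLeaves T L ∧ a ^ 2 ≤ (L.ncard : ℝ)) :
    ((Finset.univ.filter (IsLeaf T)).card : ℝ) * (a - 1) ≤ (a ^ 2 + a) ^ 2 := by
  classical
  have hnb : ∀ x, ∃ y, IsLeaf T x → T.neighborSet x = {y} := by
    intro x
    by_cases hx : IsLeaf T x
    · obtain ⟨y, hy⟩ := Set.ncard_eq_one.1 hx
      exact ⟨y, fun _ ↦ hy⟩
    · exact ⟨x, fun h ↦ absurd h hx⟩
  choose p hp using hnb
  set L := Finset.univ.filter (IsLeaf T) with hLdef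
  have hmemL : ∀ {x}, x ∈ L ↔ IsLeaf T x := by simp [hLdef]
  have hadj : ∀ {x y}, IsLeaf T x → (T.Adj x y ↔ y = p x) := fun {x y} hx ↦ by
    rw [← mem_neighborSet, hp x hx, Set.mem_singleton_iff]
  have hP : ((L.image p).card : ℝ) < a ^ 2 := by
    by_contra! h
    obtain ⟨U, hUL, hinj, himg⟩ := Finset.exists_subset_injOn_image_eq_of_surjOn
      (f := p) (s := (L : Set V)) (L.image p) (by intro x; simp)
    refine hL ⟨U, ⟨fun v hv ↦ hmemL.1 (hUL hv), ?_⟩, ?_⟩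
    · intro u hu v hv huv x y hx hy hxy
      rw [hadj (hmemL.1 (hUL hu))] at hx
      rw [hadj (hmemL.1 (hUL hv))] at hy
      exact huv (hinj hu hv (by rw [← hx, ← hy, hxy]))
    · rw [Set.ncard_coe_finset, ← Finset.card_image_of_injOn hinj, himg]
      exact h
  have hq : ((⌊a⌋₊ : ℕ) : ℝ) ≤ a := Nat.floor_le (by linarith)
  have hq' : a - 1 < ⌊a⌋₊ := Nat.sub_one_lt_floor a
  have hblock : ∀ S : Finset V, S.card ≤ ⌊a⌋₊ →
      ((L.filter (p · ∈ S)).card : ℝ) ≤ a ^ 2 + a := by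
    intro S hSq
    have hSa : (S.card : ℝ) ≤ a := le_trans (by exact_mod_cast hSq) hq
    have hlt : ((L.filter fun w ↦ p w ∈ S ∧ w ∉ S).card : ℝ) < a ^ 2 := by
      by_contra! h
      refine hS ⟨S, by rwa [Set.ncard_coe_finset], h.trans ?_⟩
      rw [← Set.ncard_coe_finset]
      refine Nat.cast_le.2 (Set.ncard_le_ncard ?_ (Set.toFinite _))
      intro w hw
      simp only [Finset.coe_filter, Set.mem_ofPred_eq, hmemL] at hw
      exact ⟨hw.2.2, ⟨p w, hw.2.1, T.adj_symm ((hadj hw.1).2 rfl)⟩, hw.1⟩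
    have hle : (L.filter (p · ∈ S)).card ≤
        (L.filter fun w ↦ p w ∈ S ∧ w ∉ S).card + S.card := by
      refine (Finset.card_le_card ?_).trans (Finset.card_union_le _ _)
      intro x hx
      simp only [Finset.mem_union, Finset.mem_filter] at hx ⊢
      tauto
    have hle' : ((L.filter (p · ∈ S)).card : ℝ) ≤
        (L.filter fun w ↦ p w ∈ S ∧ w ∉ S).card + S.card := by exact_mod_cast hle
    linarith
  have h := card_filter_mem_mul_le L p hblock (L.image p)
  rw [Finset.filter_true_of_mem fun x hx ↦ Finset.mem_image_of_mem p hx] at h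
  calc (L.card : ℝ) * (a - 1) ≤ L.card * ⌊a⌋₊ := by gcongr
    _ ≤ _ := h
    _ ≤ (a ^ 2 + a) * (a ^ 2 + a) := by gcongr
    _ = _ := by ring

/-- Claim 4.1: for `n` large and `t = ⌊n^(1/4)/10⌋`, every "path-like" tree `T` with between
`n - t + 1` and `n` vertices (no small vertex set seeing `n^(1/2)` leaves, and no `n^(1/2)`
independent leaves) contains a path on `3t + 2` vertices whose internal vertices have degree `2`
in `T`, together with a set of at least `n^(1/2)` vertices of degree `2` that are pairwise at
distance at least `2` from each other and from the endpoints of the path. -/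
theorem path_like_structure :
    ∃ N : ℕ, ∀ n : ℕ, N ≤ n →
      ∀ (m : ℕ) (T : SimpleGraph (Fin m)), T.IsTree →
        n - ⌊(1 / 10 : ℝ) * (n : ℝ) ^ ((1 : ℝ) / 4)⌋₊ + 1 ≤ m → m ≤ n →
        (¬ ∃ S : Set (Fin m), (S.ncard : ℝ) ≤ (n : ℝ) ^ ((1 : ℝ) / 4) ∧
          (n : ℝ) ^ ((1 : ℝ) / 2) ≤
            (({w | w ∉ S ∧ (∃ u ∈ S, T.Adj u w) ∧ IsLeaf T w} : Set _).ncard : ℝ)) →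
        (¬ ∃ L : Set (Fin m), IndepLeaves T L ∧
          (n : ℝ) ^ ((1 : ℝ) / 2) ≤ (L.ncard : ℝ)) →
        ∃ (u v : Fin m) (p : T.Walk u v), p.IsPath ∧
          p.length = 3 * ⌊(1 / 10 : ℝ) * (n : ℝ) ^ ((1 : ℝ) / 4)⌋₊ + 1 ∧
          (∀ w ∈ p.support, w ≠ u → w ≠ v → (T.neighborSet w).ncard = 2) ∧
          ∃ W : Set (Fin m), (n : ℝ) ^ ((1 : ℝ) / 2) ≤ (W.ncard : ℝ) ∧
            (∀ w ∈ W, (T.neighborSet w).ncard = 2) ∧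
            (∀ w ∈ W, ∀ w' ∈ W, w ≠ w' → 2 ≤ T.dist w w') ∧
            (∀ w ∈ W, 2 ≤ T.dist w u ∧ 2 ≤ T.dist w v) := by
  classical
  refine ⟨1000 ^ 4, fun n hn m T hT hmn hmn' hS hL ↦ ?_⟩
  set a : ℝ := (n : ℝ) ^ ((1 : ℝ) / 4) with ha_def
  have hn0 : (0 : ℝ) ≤ n := Nat.cast_nonneg n
  have ha4 : a ^ 4 = n := by
    rw [ha_def, ← Real.rpow_natCast, ← Real.rpow_mul hn0]
    norm_num
  have ha2 : (n : ℝ) ^ ((1 : ℝ) / 2) = a ^ 2 := by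
    rw [ha_def, ← Real.rpow_natCast, ← Real.rpow_mul hn0]
    norm_num
  have ha0 : 0 ≤ a := Real.rpow_nonneg hn0 _
  have ha : 1000 ≤ a := by
    refine le_of_pow_le_pow_left₀ (n := 4) (by norm_num) ha0 ?_
    rw [ha4]
    exact_mod_cast hn
  rw [ha2] at hS hL ⊢
  set t := ⌊(1 / 10 : ℝ) * a⌋₊ with ht_def
  have ht : (t : ℝ) ≤ a / 10 := by
    have := Nat.floor_le (a := (1 / 10 : ℝ) * a) (by positivity)
    linarith
  have hm : a ^ 4 ≤ m + a / 10 := by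
    have : n ≤ m + t := by omega
    have : (n : ℝ) ≤ m + t := by exact_mod_cast this
    rw [ha4]
    linarith
  have ha2' : 1000 * a ≤ a ^ 2 := by nlinarith
  have ha3' : 1000 * a ^ 2 ≤ a ^ 3 := by nlinarith [sq_nonneg a]
  have ha4' : 1000 * a ^ 3 ≤ a ^ 4 := by nlinarith [pow_nonneg ha0 3]
  have hm2 : 2 ≤ m := by
    have : (1 : ℝ) < m := by linarith
    have : 1 < m := by exact_mod_cast this
    omega
  have : Nontrivial (Fin m) := Fin.nontrivial_iff_two_le.2 hm2
  have hleaves := card_leaves_mul_le T (by linarith) hS hL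
  set ℓ := (Finset.univ.filter (IsLeaf T)).card
  have hℓ : (ℓ : ℝ) ≤ 11 / 10 * a ^ 3 := by
    have h1 : (a ^ 2 + a) ^ 2 ≤ 11 / 10 * a ^ 3 * (a - 1) := by nlinarith
    exact le_of_mul_le_mul_right (hleaves.trans h1) (by linarith)
  have hB := hT.card_ncard_ne_two_le
  set B := Finset.univ.filter fun x ↦ (T.neighborSet x).ncard ≠ 2 with hB_def
  have hBr : (B.card : ℝ) ≤ 2 * ℓ := by exact_mod_cast hB
  have hcount : B.card * (3 * t + 1 + 1) < Fintype.card (Fin m) := by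
    rw [Fintype.card_fin]
    have h1 : (B.card : ℝ) ≤ 22 / 10 * a ^ 3 := by linarith
    have h2 : (B.card : ℝ) * (3 * t + 1 + 1) ≤
        (22 / 10 * a ^ 3) * (3 * (a / 10) + 1 + 1) := by gcongr
    have h3 : (22 / 10 * a ^ 3) * (3 * (a / 10) + 1 + 1) < m := by nlinarith
    exact_mod_cast h2.trans_lt h3
  obtain ⟨u, v, p, hp, hlen, hpB⟩ := hT.exists_isPath_disjoint
    (fun x hx ↦ by simpa [hB_def] using fun h ↦ hx h) hcount
  have hdeg : ∀ w ∈ p.support, (T.neighborSet w).ncard = 2 := fun w hw ↦ by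
    simpa [hB_def] using fun h ↦ hpB w hw h
  refine ⟨u, v, p, hp, hlen, fun w hw _ _ ↦ hdeg w hw, ?_⟩
  have hball : ∀ x, (T.neighborSet x).ncard = 2 →
      (insert x (T.neighborSet x).toFinset).card ≤ 3 := fun x hx ↦ by
    refine (Finset.card_insert_le _ _).trans ?_
    rw [← Set.ncard_eq_toFinset_card', hx]
  set X := insert u (T.neighborSet u).toFinset ∪ insert v (T.neighborSet v).toFinset with hX_def
  have hX : X.card ≤ 6 := (Finset.card_union_le _ _).trans
    (Nat.add_le_add (hball u (hdeg u p.start_mem_support)) (hball v (hdeg v p.end_mem_support)))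
  obtain ⟨W, hWsub, hWcard, hWadj⟩ := hT.exists_subset_pairwise_not_adj (B ∪ X)ᶜ
  have hmem : ∀ w ∈ W, (T.neighborSet w).ncard = 2 ∧ w ∉ X := fun w hw ↦ by
    simpa [hB_def, not_or] using hWsub hw
  refine ⟨W, ?_, fun w hw ↦ (hmem w hw).1, fun w hw w' hw' hne ↦
    hT.connected.one_lt_dist_of_ne_of_not_adj hne (hWadj w hw w' hw'), fun w hw ↦ ?_⟩
  · rw [Set.ncard_coe_finset]
    have h1 : m ≤ 2 * W.card + (B.card + 6) := by
      have h2 := Finset.card_add_card_compl (B ∪ X)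
      have h3 := Finset.card_union_le B X
      rw [Fintype.card_fin] at h2
      omega
    have h4 : (m : ℝ) ≤ 2 * W.card + (B.card + 6) := by exact_mod_cast h1
    linarith
  · have hwX := (hmem w hw).2
    simp only [hX_def, Finset.mem_union, Finset.mem_insert, Set.mem_toFinset, mem_neighborSet,
      not_or] at hwX
    exact ⟨hT.connected.one_lt_dist_of_ne_of_not_adj hwX.1.1 fun h ↦ hwX.1.2 h.symm,
      hT.connected.one_lt_dist_of_ne_of_not_adj hwX.2.1 fun h ↦ hwX.2.2 h.symm⟩
end

section
/- Let m ≥ 1 and let T be a tree containing a vertex of degree at least 2m. Then either some vertex of T has at least m neighbors that are leaves of T (so in particular T has a single vertex whose neighborhood contains at least m leaves), or T contains a set of m independent leaves. -/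
open SimpleGraph

/-- A non-leaf with a neighbor `x` has a neighbor other than `x`. -/
theorem exists_adj_ne_of_not_isLeaf {V : Type} {G : SimpleGraph V} {w x : V} (h : G.Adj w x)
    (hw : ¬ IsLeaf G w) : ∃ y, G.Adj w y ∧ y ≠ x := by
  by_contra! hall
  refine hw (Set.ncard_eq_one.mpr ⟨x, Set.ext fun y => ⟨hall y, ?_⟩⟩)
  rintro rfl
  exact h

/-- In a finite acyclic graph, any path through the edge `vu` that goes beyond `u` shows that
there is a leaf beyond `u`, whose neighbor `x` is reached by a path starting with `vu`. -/
theorem SimpleGraph.IsAcyclic.exists_isLeaf_of_isPath {V : Type} [Fintype V] {G : SimpleGraph V}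
    (hG : G.IsAcyclic) {v u x w : V} (h : G.Adj v u) (q : G.Walk u x) (hxw : G.Adj x w)
    (hp : ((Walk.cons h q).concat hxw).IsPath) :
    ∃ (x' w' : V) (q' : G.Walk u x'), (Walk.cons h q').IsPath ∧ G.Adj x' w' ∧ IsLeaf G w' := by
  by_cases hw : IsLeaf G w
  · exact ⟨x, w, q, ((Walk.concat_isPath_iff hxw).mp hp).1, hxw, hw⟩
  obtain ⟨y, hwy, hyx⟩ := exists_adj_ne_of_not_isLeaf hxw.symm hw
  have hy : y ∉ ((Walk.cons h q).concat hxw).support := fun hmem => hyx <| by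
    rw [hG.eq_penultimate_of_adj_end hp hwy hmem, Walk.penultimate_concat]
  have hp' : ((Walk.cons h (q.concat hxw)).concat hwy).IsPath := hp.concat hy hwy
  have hlt := hp'.length_lt
  exact hG.exists_isLeaf_of_isPath h (q.concat hxw) hwy hp'
termination_by Fintype.card V - q.length
decreasing_by
  simp only [Walk.length_concat, Walk.length_cons] at hlt ⊢
  omega

/-- A non-leaf neighbor `u` of `v` in a finite acyclic graph has a leaf beyond it. -/
theorem SimpleGraph.IsAcyclic.exists_isLeaf_of_not_isLeaf {V : Type} [Fintype V]
    {G : SimpleGraph V} (hG : G.IsAcyclic) {v u : V} (h : G.Adj v u) (hu : ¬ IsLeaf G u) :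
    ∃ (x w : V) (q : G.Walk u x), (Walk.cons h q).IsPath ∧ G.Adj x w ∧ IsLeaf G w := by
  obtain ⟨z, huz, hzv⟩ := exists_adj_ne_of_not_isLeaf h.symm hu
  refine hG.exists_isLeaf_of_isPath h Walk.nil huz ?_
  simp [Walk.concat_isPath_iff, huz.ne', h.ne, hzv.symm]

/-- In a leaf, any two neighbors agree. -/
theorem IsLeaf.eq_of_adj {V : Type} {G : SimpleGraph V} {w x y : V} (hw : IsLeaf G w)
    (hx : G.Adj w x) (hy : G.Adj w y) : x = y := by
  obtain ⟨a, ha⟩ := Set.ncard_eq_one.mp hw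
  have hx' : x ∈ G.neighborSet w := hx
  have hy' : y ∈ G.neighborSet w := hy
  rw [ha] at hx' hy'
  exact hx'.trans hy'.symm

/-- If a tree has a vertex of degree at least `2m` (`m ≥ 1`), then either some vertex has at
least `m` leaf neighbors, or the tree contains a set of `m` independent leaves. -/
theorem high_degree_gives_leaves {V : Type} [Fintype V] (m : ℕ) (hm : 1 ≤ m)
    (T : SimpleGraph V) (ht : T.IsTree)
    (hdeg : ∃ v, 2 * m ≤ (T.neighborSet v).ncard) :
    (∃ v, m ≤ ({u | T.Adj v u ∧ IsLeaf T u} : Set V).ncard) ∨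
    (∃ L : Set V, IndepLeaves T L ∧ L.ncard = m) := by
  obtain ⟨v, hv⟩ := hdeg
  refine or_iff_not_imp_left.mpr fun hfew => ?_
  have hfew_v : ({u | T.Adj v u ∧ IsLeaf T u} : Set V).ncard < m :=
    not_le.mp fun hle => hfew ⟨v, hle⟩
  have hcover : T.neighborSet v =
      {u | T.Adj v u ∧ IsLeaf T u} ∪ {u | T.Adj v u ∧ ¬ IsLeaf T u} := by
    ext u
    simp only [mem_neighborSet, Set.mem_union, Set.mem_ofPred_eq]
    tauto
  have hmany : m ≤ ({u | T.Adj v u ∧ ¬ IsLeaf T u} : Set V).ncard := by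
    have := Set.ncard_union_le {u | T.Adj v u ∧ IsLeaf T u} {u | T.Adj v u ∧ ¬ IsLeaf T u}
    rw [← hcover] at this
    omega
  obtain ⟨S, hS, hScard⟩ := Set.exists_subset_card_eq hmany
  have hleaf : ∀ u : S, ∃ (x w : V) (h : T.Adj v u) (q : T.Walk u x),
      (Walk.cons h q).IsPath ∧ T.Adj x w ∧ IsLeaf T w := fun u => by
    obtain ⟨x, w, q, hq⟩ := ht.isAcyclic.exists_isLeaf_of_not_isLeaf (hS u.2).1 (hS u.2).2
    exact ⟨x, w, _, q, hq⟩
  choose x w h q hpath hadj hw using hleaf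
  have hx : Function.Injective x := by
    have key : ∀ (a b : V) (c : S), x c = b → ∀ p : T.Walk v b, p.IsPath → p.snd = a →
        a = c := by
      rintro a b c rfl p hp rfl
      rw [Subtype.mk.inj ((ht.isAcyclic.subsingleton_path _ _).elim ⟨p, hp⟩ ⟨_, hpath c⟩),
        Walk.snd_cons]
    exact fun a b hab => Subtype.ext (key a (x a) b hab.symm _ (hpath a) (Walk.snd_cons _ _))
  have hwinj : Function.Injective w := fun a b hab =>
    hx ((hw a).eq_of_adj (hadj a).symm (hab ▸ (hadj b).symm))
  refine ⟨Set.range w, ⟨?_, ?_⟩, ?_⟩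
  · rintro _ ⟨a, rfl⟩
    exact hw a
  · rintro _ ⟨a, rfl⟩ _ ⟨b, rfl⟩ hab y z hy hz rfl
    refine hab (congrArg w (hx ?_))
    rw [(hw a).eq_of_adj (hadj a).symm hy, (hw b).eq_of_adj (hadj b).symm hz]
  · rw [← Set.image_univ, Set.ncard_image_of_injective _ hwinj, Set.ncard_univ,
      Nat.card_coe_set_eq, hScard]
end
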